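/- arXiv:2404.00099 — 2 statements merged into one kernel-verified Lean document; each statement's English description precedes it below -/
import Mathlib

section
/- Let S be a measurable space, P a probability measure on S, v : S → ℝ a bounded measurable function, and τ ∈ (0,1]. Over the set of probability measures G on S with G ≪ P and dG/dP ≤ τ⁻¹ P-almost everywhere, the infimum of ∫ v dG equals CVaR⁻_τ(v; P) and the supremum of ∫ v dG equals CVaR⁺_τ(v; P). -/
open MeasureTheory

/-- Lower conditional value-at-risk at level `τ`. -/
noncomputable def cvarLower {S : Type*} [MeasurableSpace S] (τ : ℝ) (v : S → ℝ)
    (P : Measure S) : ℝ :=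
  ⨆ b : ℝ, b + τ⁻¹ * ∫ x, min (v x - b) 0 ∂P

/-- Upper conditional value-at-risk at level `τ`. -/
noncomputable def cvarUpper {S : Type*} [MeasurableSpace S] (τ : ℝ) (v : S → ℝ)
    (P : Measure S) : ℝ :=
  ⨅ b : ℝ, b + τ⁻¹ * ∫ x, max (v x - b) 0 ∂P

/-- The set of probability measures `G ≪ P` with `dG/dP ≤ τ⁻¹` `P`-a.e. -/
def cvarConstraintSet {S : Type*} [MeasurableSpace S] (τ : ℝ) (P : Measure S) :
    Set (Measure S) :=
  {G | IsProbabilityMeasure G ∧ G ≪ P ∧ ∀ᵐ x ∂P, G.rnDeriv P x ≤ ENNReal.ofReal τ⁻¹}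

open ProbabilityTheory Filter Topology

/-- A level `τ > 0` reached by the cdf has a quantile. -/
lemma exists_quantile (μ : Measure ℝ) [IsProbabilityMeasure μ] {τ t₀ : ℝ} (hτ : 0 < τ)
    (ht₀ : τ ≤ μ.real (Set.Iic t₀)) :
    ∃ b, μ.real (Set.Iio b) ≤ τ ∧ τ ≤ μ.real (Set.Iic b) := by
  set A : Set ℝ := {t | τ ≤ cdf μ t}
  have hne : A.Nonempty := ⟨t₀, by simpa [A, cdf_eq_real] using ht₀⟩
  have hbdd : BddBelow A := by
    obtain ⟨a, ha⟩ := ((tendsto_cdf_atBot μ).eventually_lt_const hτ).exists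
    refine ⟨a, fun t ht => ?_⟩
    by_contra! h
    exact absurd (ht.trans (monotone_cdf μ h.le)) (not_le.2 ha)
  refine ⟨sInf A, ?_, ?_⟩
  · have h : Function.leftLim (cdf μ) (sInf A) ≤ τ := by
      refine le_of_tendsto ((monotone_cdf μ).tendsto_leftLim (sInf A)) ?_
      filter_upwards [self_mem_nhdsWithin] with x hx
      exact (not_le.1 (notMem_of_lt_csInf (s := A) hx hbdd)).le
    have h' : μ (Set.Iio (sInf A)) = ENNReal.ofReal (Function.leftLim (cdf μ) (sInf A)) := by
      conv_lhs => rw [← measure_cdf μ, StieltjesFunction.measure_Iio _ (tendsto_cdf_atBot μ),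
        sub_zero]
    rw [measureReal_def, h']
    exact ENNReal.toReal_le_of_le_ofReal hτ.le (ENNReal.ofReal_le_ofReal h)
  · rw [← cdf_eq_real]
    refine ge_of_tendsto (((cdf μ).right_continuous (sInf A)).mono_left
      (nhdsWithin_mono _ Set.Ioi_subset_Ici_self)) ?_
    filter_upwards [self_mem_nhdsWithin] with x hx
    obtain ⟨a, ha, hax⟩ := exists_lt_of_csInf_lt hne hx
    exact ha.trans (monotone_cdf μ hax.le)

lemma cvarUpper_eq_neg_cvarLower_neg {S : Type*} [MeasurableSpace S] (τ : ℝ) (v : S → ℝ)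
    (P : Measure S) :
    cvarUpper τ v P = -cvarLower τ (fun x => -v x) P := by
  rw [cvarUpper, cvarLower, ← (Equiv.neg ℝ).iInf_comp, iSup, ← Real.sInf_neg,
    ← Set.image_neg_eq_neg, ← Set.range_comp]
  refine iInf_congr fun b => ?_
  have h (x : S) : max (v x - -b) 0 = -min (-v x - b) 0 := by
    rw [← max_neg_neg, neg_zero]
    congr 1
    ring
  simp only [Function.comp_apply, Equiv.neg_apply, h, integral_neg]
  ring

section

variable {S : Type*} [MeasurableSpace S] {P : Measure S} [IsProbabilityMeasure P] {v : S → ℝ}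
  {M τ : ℝ}

lemma integrable_of_abs_le (hv : Measurable v) (hM : ∀ x, |v x| ≤ M) (G : Measure S)
    [IsFiniteMeasure G] : Integrable v G :=
  Integrable.of_bound hv.aestronglyMeasurable M (ae_of_all _ hM)

/-- Weak duality: each dual value bounds the integral from below. -/
lemma cvar_objective_le_integral (hv : Measurable v) (hM : ∀ x, |v x| ≤ M) (hτ : 0 < τ)
    {G : Measure S} (hG : G ∈ cvarConstraintSet τ P) (b : ℝ) :
    b + τ⁻¹ * ∫ x, min (v x - b) 0 ∂P ≤ ∫ x, v x ∂G := by
  obtain ⟨hprob, hac, hle⟩ := hG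
  have hmin (Q : Measure S) [IsProbabilityMeasure Q] :
      Integrable (fun x => min (v x - b) 0) Q :=
    ((integrable_of_abs_le hv hM Q).sub (integrable_const b)).inf (integrable_const 0)
  have hdens : τ⁻¹ * ∫ x, min (v x - b) 0 ∂P ≤ ∫ x, min (v x - b) 0 ∂G := by
    rw [← integral_rnDeriv_smul hac, ← integral_const_mul]
    refine integral_mono_ae ((hmin P).const_mul _)
      ((integrable_rnDeriv_smul_iff hac).2 (hmin G)) ?_
    filter_upwards [hle] with x hx
    exact mul_le_mul_of_nonpos_right
      (ENNReal.toReal_le_of_le_ofReal (inv_nonneg.2 hτ.le) hx) (min_le_right _ _)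
  have hmono : ∫ x, min (v x - b) 0 ∂G ≤ ∫ x, (v x - b) ∂G :=
    integral_mono (hmin G) ((integrable_of_abs_le hv hM G).sub (integrable_const b))
      fun x => min_le_left _ _
  rw [integral_sub (integrable_of_abs_le hv hM G) (integrable_const b)] at hmono
  simp only [integral_const, probReal_univ, one_smul] at hmono
  linarith

/-- A bounded density integrating to one defines a member of the constraint set. -/
lemma withDensity_mem_cvarConstraintSet {g : S → ℝ} (hg : Measurable g) (hg0 : ∀ x, 0 ≤ g x)
    (hgτ : ∀ x, g x ≤ τ⁻¹) (hint : ∫ x, g x ∂P = 1) :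
    P.withDensity (fun x => ENNReal.ofReal (g x)) ∈ cvarConstraintSet τ P := by
  have hgi : Integrable g P := .of_integral_ne_zero (by simp [hint])
  refine ⟨⟨?_⟩, withDensity_absolutelyContinuous _ _, ?_⟩
  · rw [withDensity_apply _ MeasurableSet.univ, Measure.restrict_univ,
      ← ofReal_integral_eq_lintegral_ofReal hgi (ae_of_all _ hg0), hint, ENNReal.ofReal_one]
  · filter_upwards [P.rnDeriv_withDensity hg.ennreal_ofReal] with x hx
    rw [hx]
    exact ENNReal.ofReal_le_ofReal (hgτ x)

/-- The measure concentrated on the lower `τ`-tail of `v` attains a dual value. -/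
lemma exists_integral_eq_cvar_objective (hv : Measurable v) (hM : ∀ x, |v x| ≤ M)
    (hτ : τ ∈ Set.Ioc (0 : ℝ) 1) :
    ∃ G ∈ cvarConstraintSet τ P, ∃ b : ℝ,
      ∫ x, v x ∂G = b + τ⁻¹ * ∫ x, min (v x - b) 0 ∂P := by
  obtain ⟨hτ0, hτ1⟩ := hτ
  have : IsProbabilityMeasure (P.map v) := Measure.isProbabilityMeasure_map hv.aemeasurable
  obtain ⟨b, hb1, hb2⟩ := exists_quantile (P.map v) (τ := τ) (t₀ := M) hτ0 (by
    rw [map_measureReal_apply hv measurableSet_Iic,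
      Set.eq_univ_of_forall (s := v ⁻¹' Set.Iic M) fun x => (le_abs_self _).trans (hM x)]
    simpa using hτ1)
  rw [← Set.Iio_union_right, measureReal_union (by simp) (measurableSet_singleton b)] at hb2
  rw [map_measureReal_apply hv measurableSet_Iio] at hb1 hb2
  rw [map_measureReal_apply hv (measurableSet_singleton b)] at hb2
  have hL : MeasurableSet (v ⁻¹' Set.Iio b) := hv measurableSet_Iio
  have hE : MeasurableSet (v ⁻¹' {b}) := hv (measurableSet_singleton b)
  obtain ⟨c, hc0, hc1, hc⟩ : ∃ c : ℝ, 0 ≤ c ∧ c ≤ 1 ∧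
      P.real (v ⁻¹' Set.Iio b) + c * P.real (v ⁻¹' {b}) = τ := by
    rcases (measureReal_nonneg (μ := P) (s := v ⁻¹' {b})).eq_or_lt with h | h
    · exact ⟨0, le_rfl, zero_le_one, by linarith⟩
    · refine ⟨(τ - P.real (v ⁻¹' Set.Iio b)) / P.real (v ⁻¹' {b}),
        div_nonneg (by linarith) h.le, (div_le_one h).2 (by linarith), ?_⟩
      field_simp
      ring
  set g : S → ℝ := fun x => τ⁻¹ *
    ((v ⁻¹' Set.Iio b).indicator 1 x + c * (v ⁻¹' {b}).indicator 1 x) with hg_def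
  have hτi : 0 < τ⁻¹ := inv_pos.2 hτ0
  have hg : Measurable g := by
    have h1 : Measurable ((v ⁻¹' Set.Iio b).indicator (1 : S → ℝ)) :=
      measurable_one.indicator hL
    have h2 : Measurable ((v ⁻¹' {b}).indicator (1 : S → ℝ)) := measurable_one.indicator hE
    fun_prop
  have hg_cases (x : S) : (v x < b ∧ g x = τ⁻¹) ∨ (v x = b ∧ g x = τ⁻¹ * c) ∨
      (b < v x ∧ g x = 0) := by
    rcases lt_trichotomy (v x) b with h | h | h
    · exact .inl ⟨h, by simp [hg_def, h, h.ne]⟩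
    · exact .inr (.inl ⟨h, by simp [hg_def, h]⟩)
    · exact .inr (.inr ⟨h, by simp [hg_def, h.ne', h.le]⟩)
  have hg0 (x : S) : 0 ≤ g x := by
    rcases hg_cases x with ⟨-, h⟩ | ⟨-, h⟩ | ⟨-, h⟩ <;> rw [h] <;> positivity
  have hgτ (x : S) : g x ≤ τ⁻¹ := by
    rcases hg_cases x with ⟨-, h⟩ | ⟨-, h⟩ | ⟨-, h⟩ <;> rw [h]
    · exact mul_le_of_le_one_right hτi.le hc1
    · exact hτi.le
  have hint : ∫ x, g x ∂P = 1 := by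
    rw [hg_def, integral_const_mul, integral_add, integral_const_mul, integral_indicator_one hL,
      integral_indicator_one hE, hc, inv_mul_cancel₀ hτ0.ne']
    · exact (integrable_const (1 : ℝ)).indicator hL
    · exact ((integrable_const (1 : ℝ)).indicator hE).const_mul c
  refine ⟨_, withDensity_mem_cvarConstraintSet hg hg0 hgτ hint, b, ?_⟩
  rw [integral_withDensity_eq_integral_toReal_smul hg.ennreal_ofReal
    (ae_of_all _ fun _ => ENNReal.ofReal_lt_top)]
  have hpoint (x : S) : (ENNReal.ofReal (g x)).toReal • v x =
      b * g x + τ⁻¹ * min (v x - b) 0 := by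
    rw [ENNReal.toReal_ofReal (hg0 x), smul_eq_mul]
    rcases hg_cases x with ⟨h, h'⟩ | ⟨h, h'⟩ | ⟨h, h'⟩
    · rw [h', min_eq_left (by linarith)]; ring
    · rw [h', h, sub_self, min_self]; ring
    · rw [h', min_eq_right (by linarith)]; ring
  simp_rw [hpoint]
  rw [integral_add, integral_const_mul b g, hint, integral_const_mul, mul_one]
  · exact (Integrable.of_integral_ne_zero (by simp [hint])).const_mul b
  · exact (((integrable_of_abs_le hv hM P).sub (integrable_const b)).inf
      (integrable_const 0)).const_mul _

/-- The lower conditional value-at-risk is the least integral over the constraint set. -/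
lemma isLeast_cvarLower (hv : Measurable v) (hM : ∀ x, |v x| ≤ M)
    (hτ : τ ∈ Set.Ioc (0 : ℝ) 1) :
    IsLeast ((fun G : Measure S => ∫ x, v x ∂G) '' cvarConstraintSet τ P)
      (cvarLower τ v P) := by
  have hweak (G : Measure S) (hG : G ∈ cvarConstraintSet τ P) :
      cvarLower τ v P ≤ ∫ x, v x ∂G :=
    ciSup_le (cvar_objective_le_integral hv hM hτ.1 hG)
  obtain ⟨G, hG, b, hb⟩ := exists_integral_eq_cvar_objective (P := P) hv hM hτ
  refine ⟨⟨G, hG, le_antisymm (hb.le.trans (le_ciSup (f := fun b : ℝ =>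
    b + τ⁻¹ * ∫ x, min (v x - b) 0 ∂P) ⟨∫ x, v x ∂G, ?_⟩ b)) (hweak G hG)⟩, ?_⟩
  · rintro _ ⟨b', rfl⟩
    exact cvar_objective_le_integral hv hM hτ.1 hG b'
  · rintro _ ⟨Q, hQ, rfl⟩
    exact hweak Q hQ

end

/-- Over probability measures `G ≪ P` with `dG/dP ≤ τ⁻¹` a.e., the infimum of `∫ v dG`
is `CVaR⁻_τ(v;P)` and the supremum is `CVaR⁺_τ(v;P)`. -/
theorem inf_sup_density_constrained_eq_cvar
    {S : Type*} [MeasurableSpace S] (P : Measure S) [IsProbabilityMeasure P]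
    (v : S → ℝ) (hv_meas : Measurable v) (M : ℝ) (hv_bdd : ∀ x, |v x| ≤ M)
    (τ : ℝ) (hτ : τ ∈ Set.Ioc (0 : ℝ) 1) :
    sInf ((fun G : Measure S => ∫ x, v x ∂G) '' cvarConstraintSet τ P) = cvarLower τ v P ∧
    sSup ((fun G : Measure S => ∫ x, v x ∂G) '' cvarConstraintSet τ P) = cvarUpper τ v P := by
  refine ⟨(isLeast_cvarLower hv_meas hv_bdd hτ).csInf_eq, ?_⟩
  have h := isLeast_cvarLower (P := P) (v := fun x => -v x) hv_meas.neg
    (fun x => by simpa using hv_bdd x) hτ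
  simp only [integral_neg] at h
  rw [cvarUpper_eq_neg_cvarLower_neg]
  refine IsGreatest.csSup_eq ⟨?_, ?_⟩
  · obtain ⟨G, hG, hGv⟩ := h.1
    exact ⟨G, hG, by simp only at hGv ⊢; linarith⟩
  · rintro _ ⟨G, hG, rfl⟩
    have := h.2 ⟨G, hG, rfl⟩
    simp only at this ⊢
    linarith
end

section
/- In the MDP-with-data setup, let Q⁻ be a bounded measurable fixed point of the robust Bellman operator, Q⁻ = T_rob⁻ Q⁻, with V⁻(s) := ∫ Q⁻(s,a) π(da|s) and V⁻_{d₁} := (1−γ) ∫ V⁻ dd₁. Then for every bounded measurable β : S×A → ℝ and every bounded measurable nonnegative w : S×A → [0,∞): E_{ν,P}[ ψ(s,a,s'; w, Q⁻, β) ] ≤ V⁻_{d₁}, with equality if β(s,a) attains the supremum in the definition of CVaR⁻_{τ(s,a)}( V⁻ ; P(·|s,a) ) for ν-almost every (s,a). -/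
open MeasureTheory ProbabilityTheory

/-- `τ(s,a) := 1/(1+Λ(s,a))`. -/
noncomputable def tauOf {Z : Type*} (Λ : Z → ℝ) (z : Z) : ℝ := (1 + Λ z)⁻¹

/-- `λ(s,a) := 1 − Λ(s,a)⁻¹`. -/
noncomputable def lamOf {Z : Type*} (Λ : Z → ℝ) (z : Z) : ℝ := 1 - (Λ z)⁻¹

/-- `v(s) := ∫ q(s,a) π(da|s)`. -/
noncomputable def vOf {S A : Type*} [MeasurableSpace S] [MeasurableSpace A]
    (π : Kernel S A) (q : S × A → ℝ) (s : S) : ℝ :=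
  ∫ a, q (s, a) ∂(π s)

/-- Robust Bellman operator
`T_rob⁻ f(s,a) = r(s,a) + γ(1−λ) ∫ f̄ dP(·|s,a) + γ λ CVaR⁻_{τ(s,a)}(f̄; P(·|s,a))`. -/
noncomputable def robustBellman {S A : Type*} [MeasurableSpace S] [MeasurableSpace A]
    (P : Kernel (S × A) S) (π : Kernel S A) (r : S × A → ℝ) (γ : ℝ) (Λ : S × A → ℝ)
    (f : S × A → ℝ) (sa : S × A) : ℝ :=
  r sa + γ * (1 - lamOf Λ sa) * (∫ s', vOf π f s' ∂(P sa)) +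
    γ * lamOf Λ sa * cvarLower (tauOf Λ sa) (vOf π f) (P sa)

/-- `ρ(s,a,s'; v, β) = (1−λ) v(s') + λ (β(s,a) + τ⁻¹ min(v(s') − β(s,a), 0))`. -/
noncomputable def rho {S A : Type*} (Λ : S × A → ℝ) (v : S → ℝ) (β : S × A → ℝ)
    (sa : S × A) (s' : S) : ℝ :=
  (1 - lamOf Λ sa) * v s' +
    lamOf Λ sa * (β sa + (tauOf Λ sa)⁻¹ * min (v s' - β sa) 0)

/-- The (recentered) EIF integrand `ψ`. -/
noncomputable def psi {S A : Type*} [MeasurableSpace S] [MeasurableSpace A]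
    (π : Kernel S A) (r : S × A → ℝ) (γ : ℝ) (d1 : Measure S) (Λ : S × A → ℝ)
    (w q β : S × A → ℝ) (sa : S × A) (s' : S) : ℝ :=
  (1 - γ) * (∫ s, vOf π q s ∂d1) +
    w sa * (r sa + γ * rho Λ (vOf π q) β sa s' - q sa)

lemma integrable_of_abs_le_s13 {Ω : Type*} [MeasurableSpace Ω] {μ : Measure Ω} [IsFiniteMeasure μ]
    {f : Ω → ℝ} {M : ℝ} (hf : Measurable f) (hM : ∀ x, |f x| ≤ M) : Integrable f μ :=
  Integrable.of_bound hf.aestronglyMeasurable M (Filter.Eventually.of_forall hM)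

lemma abs_integral_le_of_abs_le {Ω : Type*} [MeasurableSpace Ω] {μ : Measure Ω}
    [IsProbabilityMeasure μ] {f : Ω → ℝ} {M : ℝ} (hM : ∀ x, |f x| ≤ M) :
    |∫ x, f x ∂μ| ≤ M := by
  have h := norm_integral_le_of_norm_le_const (μ := μ) (f := f) (Filter.Eventually.of_forall hM)
  simpa using h

lemma abs_min_sub_zero_le {x b M N : ℝ} (hx : |x| ≤ M) (hb : |b| ≤ N) :
    |min (x - b) 0| ≤ M + N := by
  obtain ⟨hx₁, hx₂⟩ := abs_le.mp hx
  obtain ⟨hb₁, hb₂⟩ := abs_le.mp hb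
  exact abs_le.mpr ⟨le_min (by linarith) (by linarith), (min_le_right _ _).trans (by linarith)⟩

lemma measurable_vOf {S A : Type*} [MeasurableSpace S] [MeasurableSpace A]
    (π : Kernel S A) [IsSFiniteKernel π] {q : S × A → ℝ} (hq : Measurable q) :
    Measurable (vOf π q) :=
  (hq.stronglyMeasurable.integral_kernel_prod_right' (κ := π)).measurable

/-- Each value of the variational objective is a lower bound for the CVaR at a level `τ ≤ 1`. -/
lemma le_cvarLower {S : Type*} [MeasurableSpace S] {μ : Measure S} [IsProbabilityMeasure μ]
    {τ : ℝ} (hτ : 1 ≤ τ⁻¹) {v : S → ℝ} (hv : Measurable v) {M : ℝ} (hM : ∀ x, |v x| ≤ M)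
    (b : ℝ) : b + τ⁻¹ * ∫ x, min (v x - b) 0 ∂μ ≤ cvarLower τ v μ := by
  refine le_ciSup (f := fun b : ℝ => b + τ⁻¹ * ∫ x, min (v x - b) 0 ∂μ) ⟨M, ?_⟩ b
  rintro _ ⟨c, rfl⟩
  have hint : Integrable (fun x => min (v x - c) 0) μ :=
    integrable_of_abs_le_s13 ((hv.sub_const c).min measurable_const)
      fun x => abs_min_sub_zero_le (hM x) le_rfl
  have hnonpos : ∫ x, min (v x - c) 0 ∂μ ≤ 0 :=
    integral_nonpos fun x => min_le_right _ _
  have hle : ∫ x, min (v x - c) 0 ∂μ ≤ M - c := by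
    have h := integral_mono hint (integrable_const (M - c)) fun x =>
      (min_le_left (v x - c) 0).trans (by linarith [(abs_le.mp (hM x)).2])
    simpa using h
  change c + τ⁻¹ * ∫ x, min (v x - c) 0 ∂μ ≤ M
  nlinarith

lemma one_le_inv_tauOf {Z : Type*} {Λ : Z → ℝ} {z : Z} (h : 1 ≤ Λ z) : 1 ≤ (tauOf Λ z)⁻¹ := by
  rw [tauOf, inv_inv]
  linarith

lemma lamOf_mem_Icc {Z : Type*} {Λ : Z → ℝ} {z : Z} (h : 1 ≤ Λ z) :
    lamOf Λ z ∈ Set.Icc (0 : ℝ) 1 := by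
  have h₁ : (Λ z)⁻¹ ≤ 1 := inv_le_one_of_one_le₀ h
  have h₀ : 0 ≤ (Λ z)⁻¹ := inv_nonneg.mpr (by linarith)
  exact ⟨by rw [lamOf]; linarith, by rw [lamOf]; linarith⟩

lemma abs_rho_le {S A : Type*} {Λ : S × A → ℝ} {v : S → ℝ} {β : S × A → ℝ} {sa : S × A}
    {s' : S} {L M N : ℝ} (hΛ : 1 ≤ Λ sa) (hL : Λ sa ≤ L) (hv : |v s'| ≤ M) (hβ : |β sa| ≤ N) :
    |rho Λ v β sa s'| ≤ M + (N + (1 + L) * (M + N)) := by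
  obtain ⟨h₀, h₁⟩ := lamOf_mem_Icc hΛ
  have hmin := abs_min_sub_zero_le hv hβ
  have hinner : |β sa + (tauOf Λ sa)⁻¹ * min (v s' - β sa) 0| ≤ N + (1 + L) * (M + N) := by
    refine (abs_add_le _ _).trans (add_le_add hβ ?_)
    rw [abs_mul, tauOf, inv_inv, abs_of_nonneg (by linarith : 0 ≤ 1 + Λ sa)]
    exact mul_le_mul (by linarith) hmin (abs_nonneg _) (by linarith)
  refine (abs_add_le _ _).trans (add_le_add ?_ ?_)
  · rw [abs_mul, abs_of_nonneg (by linarith : 0 ≤ 1 - lamOf Λ sa)]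
    exact (mul_le_of_le_one_left (abs_nonneg _) (by linarith)).trans hv
  · rw [abs_mul, abs_of_nonneg h₀]
    exact (mul_le_of_le_one_left (abs_nonneg _) h₁).trans hinner

lemma measurable_uncurry_psi {S A : Type*} [MeasurableSpace S] [MeasurableSpace A]
    (π : Kernel S A) [IsSFiniteKernel π] {r : S × A → ℝ} (hr : Measurable r) (γ : ℝ)
    (d1 : Measure S) {Λ : S × A → ℝ} (hΛ : Measurable Λ) {w q β : S × A → ℝ}
    (hw : Measurable w) (hq : Measurable q) (hβ : Measurable β) :
    Measurable fun p : (S × A) × S => psi π r γ d1 Λ w q β p.1 p.2 := by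
  have hv := measurable_vOf π hq
  unfold psi rho lamOf tauOf
  fun_prop

/-- Conditionally on `(s,a)`, the integrand `ψ` at a fixed point of the robust Bellman operator is
off from the target by the weighted suboptimality gap of `β` in the CVaR problem. -/
lemma integral_psi_eq_of_fixed {S A : Type*} [MeasurableSpace S] [MeasurableSpace A]
    (P : Kernel (S × A) S) [IsMarkovKernel P] (π : Kernel S A) [IsMarkovKernel π]
    (r : S × A → ℝ) (γ : ℝ) (d1 : Measure S) (Λ w β : S × A → ℝ)
    {q : S × A → ℝ} (hq : Measurable q) {M : ℝ} (hM : ∀ sa, |q sa| ≤ M) (sa : S × A)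
    (hfix : q sa = robustBellman P π r γ Λ q sa) :
    ∫ s', psi π r γ d1 Λ w q β sa s' ∂(P sa) =
      (1 - γ) * (∫ s, vOf π q s ∂d1) + w sa * (γ * lamOf Λ sa *
        ((β sa + (tauOf Λ sa)⁻¹ * ∫ s', min (vOf π q s' - β sa) 0 ∂(P sa)) -
          cvarLower (tauOf Λ sa) (vOf π q) (P sa))) := by
  have hv := measurable_vOf π hq
  have hvM : ∀ s, |vOf π q s| ≤ M := fun s => abs_integral_le_of_abs_le fun a => hM (s, a)
  have hintv : Integrable (vOf π q) (P sa) := integrable_of_abs_le_s13 hv hvM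
  have hintm : Integrable (fun s' => min (vOf π q s' - β sa) 0) (P sa) :=
    integrable_of_abs_le_s13 ((hv.sub_const _).min measurable_const)
      fun x => abs_min_sub_zero_le (hvM x) le_rfl
  have hpsi : ∀ s', psi π r γ d1 Λ w q β sa s' =
      ((1 - γ) * (∫ s, vOf π q s ∂d1) + w sa * (r sa + γ * lamOf Λ sa * β sa - q sa)) +
        (w sa * γ * (1 - lamOf Λ sa) * vOf π q s' +
          w sa * γ * lamOf Λ sa * (tauOf Λ sa)⁻¹ * min (vOf π q s' - β sa) 0) := by
    intro s'
    rw [psi, rho]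
    ring
  simp_rw [hpsi]
  rw [integral_add (integrable_const _) ((hintv.const_mul _).fun_add (hintm.const_mul _)),
    integral_add (hintv.const_mul _) (hintm.const_mul _), integral_const_mul, integral_const_mul,
    integral_const, hfix, robustBellman]
  simp only [probReal_univ, one_smul]
  ring

/-- Validity with correct `Q⁻`: if `Q⁻` is a bounded measurable fixed point of the robust
Bellman operator, then for any bounded measurable `β` and any nonnegative bounded measurable
`w`, `E_{ν,P}[ψ(s,a,s'; w, Q⁻, β)] ≤ V⁻_{d₁}`, with equality when `β` attains the supremum
in the CVaR `ν`-a.e. -/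
theorem validity_correct_Q
    {S A : Type*} [MeasurableSpace S] [MeasurableSpace A]
    (P : Kernel (S × A) S) [IsMarkovKernel P] (π : Kernel S A) [IsMarkovKernel π]
    (r : S × A → ℝ) (hr_meas : Measurable r) (hr_bdd : ∀ z, r z ∈ Set.Icc (0 : ℝ) 1)
    (γ : ℝ) (hγ : γ ∈ Set.Ico (0 : ℝ) 1)
    (d1 : Measure S) [IsProbabilityMeasure d1]
    (ν : Measure (S × A)) [IsProbabilityMeasure ν]
    (Λ : S × A → ℝ) (hΛ_meas : Measurable Λ) (hΛ_lb : ∀ sa, 1 ≤ Λ sa)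
    (MΛ : ℝ) (hΛ_ub : ∀ sa, Λ sa ≤ MΛ)
    (Qm : S × A → ℝ) (hQ_meas : Measurable Qm) (MQ : ℝ) (hQ_bdd : ∀ sa, |Qm sa| ≤ MQ)
    (hQ_fixed : ∀ sa, Qm sa = robustBellman P π r γ Λ Qm sa)
    (β : S × A → ℝ) (hβ_meas : Measurable β) (Mβ : ℝ) (hβ_bdd : ∀ sa, |β sa| ≤ Mβ)
    (w : S × A → ℝ) (hw_meas : Measurable w) (Mw : ℝ) (hw_bdd : ∀ sa, |w sa| ≤ Mw)
    (hw_nonneg : ∀ sa, 0 ≤ w sa) :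
    (∫ sa, ∫ s', psi π r γ d1 Λ w Qm β sa s' ∂(P sa) ∂ν) ≤
      (1 - γ) * (∫ s, vOf π Qm s ∂d1) ∧
    ((∀ᵐ sa ∂ν,
        β sa + (tauOf Λ sa)⁻¹ * (∫ s', min (vOf π Qm s' - β sa) 0 ∂(P sa)) =
          cvarLower (tauOf Λ sa) (vOf π Qm) (P sa)) →
      (∫ sa, ∫ s', psi π r γ d1 Λ w Qm β sa s' ∂(P sa) ∂ν) =
        (1 - γ) * (∫ s, vOf π Qm s ∂d1)) := by
  have hvM : ∀ s, |vOf π Qm s| ≤ MQ := fun s => abs_integral_le_of_abs_le fun a => hQ_bdd (s, a)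
  have hinner := fun sa =>
    integral_psi_eq_of_fixed P π r γ d1 Λ w β hQ_meas hQ_bdd sa (hQ_fixed sa)
  constructor
  · have hint : Integrable (fun sa => ∫ s', psi π r γ d1 Λ w Qm β sa s' ∂(P sa)) ν := by
      refine integrable_of_abs_le_s13 (M := |(1 - γ) * (∫ s, vOf π Qm s ∂d1)| +
        Mw * (1 + γ * (MQ + (Mβ + (1 + MΛ) * (MQ + Mβ))) + MQ)) ?_ fun sa => ?_
      · exact ((measurable_uncurry_psi π hr_meas γ d1 hΛ_meas hw_meas hQ_meas
          hβ_meas).stronglyMeasurable.integral_kernel_prod_right' (κ := P)).measurable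
      · refine abs_integral_le_of_abs_le fun s' => ?_
        have hrho := abs_rho_le (hΛ_lb sa) (hΛ_ub sa) (hvM s') (hβ_bdd sa)
        have hr : |r sa| ≤ 1 := abs_le.mpr ⟨by linarith [(hr_bdd sa).1], (hr_bdd sa).2⟩
        refine (abs_add_le _ _).trans (add_le_add le_rfl ?_)
        rw [abs_mul]
        refine mul_le_mul (hw_bdd sa) ?_ (abs_nonneg _) ((abs_nonneg _).trans (hw_bdd sa))
        refine (abs_sub _ _).trans (add_le_add ((abs_add_le _ _).trans (add_le_add hr ?_))
          (hQ_bdd sa))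
        rw [abs_mul, abs_of_nonneg hγ.1]
        exact mul_le_mul_of_nonneg_left hrho hγ.1
    have hle := integral_mono hint (integrable_const ((1 - γ) * (∫ s, vOf π Qm s ∂d1)))
      fun sa => by
        have hgap := le_cvarLower (μ := P sa) (one_le_inv_tauOf (hΛ_lb sa))
          (measurable_vOf π hQ_meas) hvM (β sa)
        have hterm := mul_nonpos_of_nonneg_of_nonpos (hw_nonneg sa)
          (mul_nonpos_of_nonneg_of_nonpos (mul_nonneg hγ.1 (lamOf_mem_Icc (hΛ_lb sa)).1)
            (sub_nonpos.mpr hgap))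
        simp only [hinner]
        linarith
    simpa using hle
  · intro hβ
    have hae : (fun sa => ∫ s', psi π r γ d1 Λ w Qm β sa s' ∂(P sa)) =ᵐ[ν]
        fun _ => (1 - γ) * (∫ s, vOf π Qm s ∂d1) := by
      filter_upwards [hβ] with sa hsa
      rw [hinner, hsa, sub_self, mul_zero, mul_zero, add_zero]
    rw [integral_congr_ae hae]
    simp
end
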